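/- arXiv:math/0501227 — 2 statements merged into one kernel-verified Lean document; each statement's English description precedes it below -/
import Mathlib

section
/- Let 1 ≤ r ≤ n be integers and let I' ⊆ {1,…,n} with |I'| = r. Then the smallest convex cone in ℝⁿ containing the translated hypersimplex {x − e_{I'} : x ∈ Δ(r,n)} equals the convex cone generated by the vectors {e_j − e_i : j ∉ I', i ∈ I'}; that is, the cone of the hypersimplex at its vertex e_{I'} is generated by the edge directions e_j − e_i. -/
/-- The hypersimplex `Δ(r,n) = {x ∈ ℝⁿ : ∑ᵢ xᵢ = r, 0 ≤ xᵢ ≤ 1}`. -/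
def hypersimplex (r n : ℕ) : Set (Fin n → ℝ) :=
  {x | (∑ i, x i) = (r : ℝ) ∧ ∀ i, 0 ≤ x i ∧ x i ≤ 1}

/-- For `S ⊆ {1,…,n}`, the 0/1 vector `e_S = ∑_{i ∈ S} eᵢ`. -/
def vertexVec {n : ℕ} (S : Finset (Fin n)) : Fin n → ℝ :=
  fun i => if i ∈ S then 1 else 0

/-- A pointed convex cone: a set containing `0`, closed under addition and under
multiplication by nonnegative real scalars. -/
def IsPointedCone {E : Type*} [AddCommMonoid E] [Module ℝ E] (C : Set E) : Prop :=
  (0 : E) ∈ C ∧ (∀ x ∈ C, ∀ y ∈ C, x + y ∈ C) ∧ ∀ c : ℝ, 0 ≤ c → ∀ x ∈ C, c • x ∈ C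

/-- The smallest pointed convex cone containing a set `S`. -/
def coneHull {E : Type*} [AddCommMonoid E] [Module ℝ E] (S : Set E) : Set E :=
  ⋂₀ {C : Set E | S ⊆ C ∧ IsPointedCone C}

theorem coneHull_mono_aux {E : Type*} [AddCommMonoid E] [Module ℝ E] {S T : Set E}
    (h : ∀ C : Set E, T ⊆ C → IsPointedCone C → S ⊆ C) : coneHull S ⊆ coneHull T := by
  intro x hx C hC
  exact hx C ⟨h C hC.1 hC.2, hC.2⟩

theorem cone_sum_mem {E ι : Type*} [AddCommMonoid E] [Module ℝ E] {C : Set E}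
    (hC : IsPointedCone C) (s : Finset ι) (f : ι → E) (h : ∀ i ∈ s, f i ∈ C) :
    ∑ i ∈ s, f i ∈ C := by
  classical
  induction s using Finset.induction_on with
  | empty => simpa using hC.1
  | insert a s ha ih =>
    rw [Finset.sum_insert ha]
    exact hC.2.1 _ (h a (by simp)) _ (ih fun i hi => h i (by simp [hi]))

theorem sum_vertexVec {n : ℕ} (S : Finset (Fin n)) : ∑ i, vertexVec S i = (S.card : ℝ) := by
  simp [vertexVec]

/-- The cone of the hypersimplex `Δ(r,n)` at its vertex `e_{I'}` (`|I'| = r`) is generated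
by the edge directions `e_j − e_i`, `j ∉ I'`, `i ∈ I'`. -/
theorem vertex_cone_hypersimplex (r n : ℕ) (h1 : 1 ≤ r) (hrn : r ≤ n)
    (I' : Finset (Fin n)) (hI' : I'.card = r) :
    coneHull {y : Fin n → ℝ | ∃ x ∈ hypersimplex r n, y = x - vertexVec I'} =
      coneHull {v : Fin n → ℝ | ∃ j ∉ I', ∃ i ∈ I', v = vertexVec {j} - vertexVec {i}} := by
  apply Set.Subset.antisymm
  · apply coneHull_mono_aux
    rintro C hTC hC y ⟨x, ⟨hxs, hx⟩, rfl⟩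
    obtain ⟨y, hy⟩ : ∃ y, y = x - vertexVec I' := ⟨_, rfl⟩
    rw [← hy]
    have hyj : ∀ j ∉ I', 0 ≤ y j := by
      intro j hj
      simp [hy, vertexVec, hj, (hx j).1]
    have hyi : ∀ i ∈ I', y i ≤ 0 := by
      intro j hj
      simp [hy, vertexVec, hj, (hx j).2]
    have hsum : ∑ i, y i = 0 := by
      simp only [hy, Pi.sub_apply, Finset.sum_sub_distrib, sum_vertexVec, hxs, hI', sub_self]
    have hsplit := Finset.sum_add_sum_compl I' y
    rw [hsum] at hsplit
    obtain ⟨s, hs⟩ : ∃ s, s = ∑ j ∈ I'ᶜ, y j := ⟨_, rfl⟩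
    have hs' : ∑ i ∈ I', y i = -s := by linarith
    have hs0 : 0 ≤ s := by
      rw [hs]; exact Finset.sum_nonneg fun j hj => hyj j (by simpa using hj)
    rcases hs0.eq_or_lt with h0 | hpos
    · have : y = 0 := by
        funext k
        by_cases hk : k ∈ I'
        · exact (Finset.sum_eq_zero_iff_of_nonpos hyi).1 (by rw [hs', ← h0, neg_zero]) k hk
        · exact (Finset.sum_eq_zero_iff_of_nonneg
            (fun j hj => hyj j (by simpa using hj))).1 (hs.symm.trans h0.symm) k (by simpa using hk)
      rw [this]; exact hC.1
    · have key : y = ∑ j ∈ I'ᶜ, ∑ i ∈ I',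
          (y j * (-y i) / s) • (vertexVec {j} - vertexVec {i}) := by
        funext k
        have e1 : ∀ j, ∑ i ∈ I', y j * (-y i) / s = y j := by
          intro j
          rw [← Finset.sum_div, ← Finset.mul_sum, Finset.sum_neg_distrib, hs']
          field_simp
        have e2 : ∀ i, ∑ j ∈ I'ᶜ, y j * (-y i) / s = -y i := by
          intro i
          rw [← Finset.sum_div, ← Finset.sum_mul, ← hs]
          field_simp
        simp only [Finset.sum_apply, Pi.smul_apply, Pi.sub_apply, smul_eq_mul, mul_sub,
          Finset.sum_sub_distrib]
        rw [Finset.sum_comm (s := I'ᶜ) (t := I') (f := fun j i =>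
          y j * (-y i) / s * vertexVec {i} k)]
        simp only [← Finset.sum_mul, e1, e2]
        simp only [vertexVec, Finset.mem_singleton, mul_ite, mul_one, mul_zero, Finset.sum_ite_eq,
          Finset.mem_compl]
        by_cases hk : k ∈ I' <;> simp [hk]
      rw [key]
      refine cone_sum_mem hC _ _ fun j hj => cone_sum_mem hC _ _ fun i hi => ?_
      have hj' : j ∉ I' := by simpa using hj
      exact hC.2.2 _ (div_nonneg (mul_nonneg (hyj j hj') (by linarith [hyi i hi])) hs0) _
        (hTC ⟨j, hj', i, hi, rfl⟩)
  · apply coneHull_mono_aux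
    rintro C hTC hC v ⟨j, hj, i, hi, rfl⟩
    apply hTC
    refine ⟨vertexVec I' + (vertexVec {j} - vertexVec {i}), ⟨?_, ?_⟩, by simp⟩
    · simp [Finset.sum_add_distrib, Finset.sum_sub_distrib, sum_vertexVec, hI']
    · intro k
      simp only [vertexVec, Pi.add_apply, Pi.sub_apply, Finset.mem_singleton]
      by_cases hkj : k = j
      · have : k ≠ i := by rintro rfl; exact hj (hkj ▸ hi)
        subst hkj
        simp [hj, this]
      · by_cases hki : k = i
        · subst hki
          simp [hi, hkj]
        · by_cases hk : k ∈ I' <;> simp [hk, hkj, hki]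
end

section
/- Let 1 ≤ r < n be integers, I ⊆ {1,…,n} with |I| = r − 1, i_r ∉ I, and I' = I ∪ {i_r}. Let L ⊆ ℝⁿ be the ℝ-linear span of {e_j − e_{i_r} : j ∉ I'} and let π : ℝⁿ → ℝⁿ/L be the quotient map. Then: (i) the image under π of the convex cone generated by {e_j − e_i : j ∉ I', i ∈ I'} equals the convex cone generated by the r − 1 vectors {π(e_{i_r} − e_i) : i ∈ I}; and (ii) the family (π(e_{i_r} − e_i))_{i ∈ I} is linearly independent in ℝⁿ/L. In particular the quotient of the vertex cone of the hypersimplex Δ(r,n) at e_{I'} by the span of the face Γ = ⋂_{i∈I}(xᵢ = 1) is a simplicial cone. -/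
theorem subset_coneHull_aux {E : Type*} [AddCommMonoid E] [Module ℝ E] (S : Set E) :
    S ⊆ coneHull S := fun _ hx _ hC => hC.1 hx

theorem isPointedCone_coneHull_aux {E : Type*} [AddCommMonoid E] [Module ℝ E] (S : Set E) :
    IsPointedCone (coneHull S) :=
  ⟨fun _ hC => hC.2.1, fun x hx y hy C hC => hC.2.2.1 x (hx C hC) y (hy C hC),
    fun c hc x hx C hC => hC.2.2.2 c hc x (hx C hC)⟩

theorem coneHull_min_aux {E : Type*} [AddCommMonoid E] [Module ℝ E] {S C : Set E}
    (h : S ⊆ C) (hC : IsPointedCone C) : coneHull S ⊆ C := fun _ hx => hx C ⟨h, hC⟩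

theorem image_coneHull_aux {E F : Type*} [AddCommMonoid E] [Module ℝ E] [AddCommMonoid F]
    [Module ℝ F] (f : E →ₗ[ℝ] F) (S : Set E) : f '' coneHull S = coneHull (f '' S) := by
  apply Set.Subset.antisymm
  · rw [Set.image_subset_iff]
    obtain ⟨h0, ha, hs⟩ := isPointedCone_coneHull_aux (f '' S)
    refine coneHull_min_aux (fun x hx => subset_coneHull_aux _ ⟨x, hx, rfl⟩) ⟨?_, ?_, ?_⟩
    · simpa using h0
    · intro x hx y hy
      simpa using ha _ hx _ hy
    · intro c hc x hx
      simpa using hs c hc _ hx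
  · obtain ⟨h0, ha, hs⟩ := isPointedCone_coneHull_aux S
    refine coneHull_min_aux (Set.image_mono (subset_coneHull_aux S)) ⟨⟨0, h0, by simp⟩, ?_, ?_⟩
    · rintro _ ⟨x, hx, rfl⟩ _ ⟨y, hy, rfl⟩
      exact ⟨x + y, ha x hx y hy, by simp⟩
    · rintro c hc _ ⟨x, hx, rfl⟩
      exact ⟨c • x, hs c hc x hx, by simp⟩

/-- The quotient of the vertex cone of `Δ(r,n)` at `e_{I'}` (`I' = I ∪ {i_r}`) by the linear
span `L` of the face `Γ = ⋂_{i ∈ I} (xᵢ = 1)` is the simplicial cone generated by the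
linearly independent vectors `π(e_{i_r} − e_i)`, `i ∈ I`. -/
theorem quotient_vertex_cone_simplicial (r n : ℕ) (h1 : 1 ≤ r) (hrn : r < n)
    (I : Finset (Fin n)) (hI : I.card = r - 1) (ir : Fin n) (hir : ir ∉ I)
    (L : Submodule ℝ (Fin n → ℝ))
    (hL : L = Submodule.span ℝ
      {v : Fin n → ℝ | ∃ j ∉ insert ir I, v = vertexVec {j} - vertexVec {ir}}) :
    (L.mkQ '' coneHull {v : Fin n → ℝ |
        ∃ j ∉ insert ir I, ∃ i ∈ insert ir I, v = vertexVec {j} - vertexVec {i}} =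
      coneHull {w : (Fin n → ℝ) ⧸ L |
        ∃ i ∈ I, w = L.mkQ (vertexVec {ir} - vertexVec {i})}) ∧
    LinearIndependent ℝ
      (fun i : {i : Fin n // i ∈ I} => L.mkQ (vertexVec {ir} - vertexVec {i.1})) := by
  have hmem : ∀ j ∉ insert ir I, L.mkQ (vertexVec {j}) = L.mkQ (vertexVec {ir}) := by
    intro j hj
    rw [← sub_eq_zero, ← map_sub, Submodule.mkQ_apply, Submodule.Quotient.mk_eq_zero, hL]
    exact Submodule.subset_span ⟨j, hj, rfl⟩
  constructor
  · rw [image_coneHull_aux]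
    apply Set.Subset.antisymm
    · refine coneHull_min_aux ?_ (isPointedCone_coneHull_aux _)
      rintro _ ⟨_, ⟨j, hj, i, hi, rfl⟩, rfl⟩
      rw [map_sub, hmem j hj, ← map_sub]
      rcases Finset.mem_insert.1 hi with rfl | hi
      · rw [sub_self, map_zero]
        exact (isPointedCone_coneHull_aux _).1
      · exact subset_coneHull_aux _ ⟨i, hi, rfl⟩
    · refine coneHull_min_aux ?_ (isPointedCone_coneHull_aux _)
      rintro _ ⟨i, hi, rfl⟩
      obtain ⟨j, hj⟩ : ∃ j, j ∉ insert ir I := by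
        by_contra! h
        have h2 : insert ir I = Finset.univ := Finset.eq_univ_iff_forall.2 h
        have h3 := Finset.card_insert_of_notMem hir
        rw [h2, Finset.card_univ, Fintype.card_fin] at h3
        omega
      refine subset_coneHull_aux _
        ⟨_, ⟨j, hj, i, Finset.mem_insert_of_mem hi, rfl⟩, ?_⟩
      rw [map_sub, hmem j hj, ← map_sub]
  · let φ : (Fin n → ℝ) →ₗ[ℝ] ({i : Fin n // i ∈ I} → ℝ) :=
      LinearMap.pi fun i => -LinearMap.proj i.1
    have hφ : L ≤ LinearMap.ker φ := by
      rw [hL, Submodule.span_le]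
      rintro _ ⟨j, hj, rfl⟩
      rw [SetLike.mem_coe, LinearMap.mem_ker]
      ext ⟨k, hk⟩
      have hkj : k ≠ j := by
        rintro rfl
        exact hj (Finset.mem_insert_of_mem hk)
      have hkr : k ≠ ir := by
        rintro rfl
        exact hir hk
      simp [φ, vertexVec, hkj, hkr]
    apply LinearIndependent.of_comp (L.liftQ φ hφ)
    have key : (L.liftQ φ hφ) ∘
        (fun i : {i : Fin n // i ∈ I} => L.mkQ (vertexVec {ir} - vertexVec {i.1})) =
        Pi.basisFun ℝ {i : Fin n // i ∈ I} := by
      ext i ⟨k, hk⟩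
      have hkr : k ≠ ir := by
        rintro rfl
        exact hir hk
      simp [φ, vertexVec, hkr, Pi.single_apply, Subtype.ext_iff]
    rw [key]
    exact (Pi.basisFun ℝ {i : Fin n // i ∈ I}).linearIndependent
end
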